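/- arXiv:1104.2270 — 8 statements merged into one kernel-verified Lean document; each statement's English description precedes it below -/
import Mathlib

section
/- Let X, Y be n×n complex matrices and let ζ ∈ ℂ. Set W_ζ = {(Xv + ζYv, ζv) : v ∈ ℂⁿ} ⊆ ℂⁿ × ℂⁿ and W'_ζ = {(ζ̄w, (X̄ + ζ̄Ȳ)w) : w ∈ ℂⁿ} ⊆ ℂⁿ × ℂⁿ (the image of W_ζ under the antilinear involution τ(a,b) = (b̄, ā)). Then W_ζ and W'_ζ are complementary complex subspaces of ℂⁿ × ℂⁿ (i.e. W_ζ ∩ W'_ζ = {0} and W_ζ + W'_ζ = ℂⁿ × ℂⁿ) if and only if for every nonzero v ∈ ℂⁿ, (X+ζY)v ≠ ζ̄v̄ and (X+ζY)v ≠ −ζ̄v̄. -/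
open Matrix Pointwise

/-- The linear map `(v, w) ↦ (Av + c̄w, cv + Āw)` on `ℂⁿ × ℂⁿ`. -/
noncomputable def conjBlockMap {n : ℕ} (A : Matrix (Fin n) (Fin n) ℂ) (c : ℂ) :
    ((Fin n → ℂ) × (Fin n → ℂ)) →ₗ[ℂ] ((Fin n → ℂ) × (Fin n → ℂ)) :=
  (LinearMap.coprod A.mulVecLin (starRingEnd ℂ c • LinearMap.id)).prod
    (LinearMap.coprod (c • LinearMap.id) (A.map (starRingEnd ℂ)).mulVecLin)

lemma conjBlockMap_apply {n : ℕ} (A : Matrix (Fin n) (Fin n) ℂ) (c : ℂ) (v w : Fin n → ℂ) :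
    conjBlockMap A c (v, w) = (A.mulVec v + starRingEnd ℂ c • w,
      c • v + (A.map (starRingEnd ℂ)).mulVec w) := by
  simp [conjBlockMap]

lemma star_mulVec_eq_map_conj_mulVec {n : ℕ} (A : Matrix (Fin n) (Fin n) ℂ) (v : Fin n → ℂ) :
    star (A.mulVec v) = (A.map (starRingEnd ℂ)).mulVec (star v) := by
  ext i
  simp [Matrix.mulVec, dotProduct]

/-- `conjBlockMap A c` is injective iff `Av = ±c̄v̄` has no nonzero solution. -/
lemma conjBlockMap_injective_iff {n : ℕ} (A : Matrix (Fin n) (Fin n) ℂ) (c : ℂ) :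
    Function.Injective (conjBlockMap A c) ↔ ∀ v : Fin n → ℂ, v ≠ 0 →
      A.mulVec v ≠ starRingEnd ℂ c • star v ∧ A.mulVec v ≠ -(starRingEnd ℂ c • star v) := by
  rw [injective_iff_map_eq_zero]
  constructor
  · intro h v hv
    constructor <;> intro hA
    · refine hv (congrArg Prod.fst (h (v, -star v) ?_))
      rw [conjBlockMap_apply, Matrix.mulVec_neg, ← star_mulVec_eq_map_conj_mulVec, hA]
      simp
    · refine hv (congrArg Prod.fst (h (v, star v) ?_))
      rw [conjBlockMap_apply, ← star_mulVec_eq_map_conj_mulVec, hA]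
      simp
  · rintro h ⟨v, w⟩ hvw
    rw [conjBlockMap_apply, Prod.mk_eq_zero] at hvw
    obtain ⟨h₁, h₂⟩ := hvw
    have h₃ : starRingEnd ℂ c • star v + A.mulVec (star w) = 0 := by
      have h₄ := congrArg star h₂
      rw [star_add, star_mulVec_eq_map_conj_mulVec, Matrix.map_map] at h₄
      simpa [Function.comp_def] using h₄
    have hu : v + star w = 0 := by
      by_contra hu
      refine (h _ hu).2 ?_
      rw [Matrix.mulVec_add, star_add, star_star, smul_add, eq_neg_of_add_eq_zero_left h₁,
        eq_neg_of_add_eq_zero_right h₃]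
      abel
    have hw : w = -star v := by
      rw [eq_neg_of_add_eq_zero_left hu]
      simp
    have hv : v = 0 := by
      by_contra hv
      refine (h v hv).1 ?_
      rw [eq_neg_of_add_eq_zero_left h₁, hw]
      simp
    simp [hw, hv]

/-- The translation step in the proof of Proposition 3.4: the subspace
`W_ζ = {(Xv + ζYv, ζv)}` and its image `W'_ζ = {(ζ̄w, (X̄+ζ̄Ȳ)w)}` under the
antilinear involution `τ(a,b) = (b̄,ā)` are complementary in `ℂⁿ × ℂⁿ` iff
`(X+ζY)v ≠ ±ζ̄·v̄` for every nonzero `v`. -/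
theorem stmt_4 (n : ℕ) (X Y : Matrix (Fin n) (Fin n) ℂ) (ζ : ℂ) :
    (({p : (Fin n → ℂ) × (Fin n → ℂ) |
        ∃ v : Fin n → ℂ, p = (X.mulVec v + ζ • Y.mulVec v, ζ • v)} ∩
      {p : (Fin n → ℂ) × (Fin n → ℂ) |
        ∃ w : Fin n → ℂ, p = ((starRingEnd ℂ ζ) • w,
          (X.map (starRingEnd ℂ) + (starRingEnd ℂ ζ) • Y.map (starRingEnd ℂ)).mulVec w)}
        = {0}) ∧
      ({p : (Fin n → ℂ) × (Fin n → ℂ) |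
        ∃ v : Fin n → ℂ, p = (X.mulVec v + ζ • Y.mulVec v, ζ • v)} +
      {p : (Fin n → ℂ) × (Fin n → ℂ) |
        ∃ w : Fin n → ℂ, p = ((starRingEnd ℂ ζ) • w,
          (X.map (starRingEnd ℂ) + (starRingEnd ℂ ζ) • Y.map (starRingEnd ℂ)).mulVec w)}
        = Set.univ))
    ↔
    ∀ v : Fin n → ℂ, v ≠ 0 →
      (X + ζ • Y).mulVec v ≠ (starRingEnd ℂ ζ) • star v ∧
      (X + ζ • Y).mulVec v ≠ -((starRingEnd ℂ ζ) • star v) := by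
  have hX (v : Fin n → ℂ) : X.mulVec v + ζ • Y.mulVec v = (X + ζ • Y).mulVec v := by
    rw [Matrix.add_mulVec, Matrix.smul_mulVec]
  have hC : X.map (starRingEnd ℂ) + (starRingEnd ℂ ζ) • Y.map (starRingEnd ℂ)
      = (X + ζ • Y).map (starRingEnd ℂ) := by
    ext i j
    simp
  simp only [hX, hC]
  generalize X + ζ • Y = A
  rw [← conjBlockMap_injective_iff]
  constructor
  · rintro ⟨-, hsum⟩
    rw [LinearMap.injective_iff_surjective]
    intro p
    obtain ⟨_, ⟨v, rfl⟩, _, ⟨w, rfl⟩, hp⟩ := Set.mem_add.1 (hsum ▸ Set.mem_univ p)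
    exact ⟨(v, w), by rw [conjBlockMap_apply, ← hp, Prod.mk_add_mk]⟩
  · intro hinj
    refine ⟨Set.eq_singleton_iff_unique_mem.2 ⟨⟨⟨0, Prod.ext (by simp) (by simp)⟩,
      ⟨0, Prod.ext (by simp) (by simp)⟩⟩, ?_⟩,
      Set.eq_univ_of_forall fun p => ?_⟩
    · rintro p ⟨⟨v, hv⟩, ⟨w, hw⟩⟩
      have hker : conjBlockMap A ζ (v, -w) = 0 := by
        obtain ⟨h₁, h₂⟩ := Prod.mk.inj (hv.symm.trans hw)
        rw [conjBlockMap_apply, h₁, h₂, Matrix.mulVec_neg]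
        simp
      have hv0 : v = 0 :=
        congrArg Prod.fst ((injective_iff_map_eq_zero _).1 hinj _ hker)
      simp [hv, hv0]
    · obtain ⟨⟨v, w⟩, rfl⟩ := LinearMap.injective_iff_surjective.1 hinj p
      exact Set.mem_add.2 ⟨_, ⟨v, rfl⟩, _, ⟨w, rfl⟩, by
        rw [conjBlockMap_apply, Prod.mk_add_mk]⟩
end

section
/- Let X, Y be n×n complex matrices such that for every ζ ∈ ℂ and every nonzero v ∈ ℂⁿ, (X+ζY)v ≠ ζ̄v̄ and (X+ζY)v ≠ −ζ̄v̄, and for every nonzero v ∈ ℂⁿ, Yv ≠ v̄ and Yv ≠ −v̄. Then n is even. -/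
open Matrix

/-- The determinant of an antisymmetric matrix indexed by `Fin n` is a square. -/
theorem exists_sq_eq_det_of_transpose_eq_neg_fin {K : Type*} [Field K] (h2 : (2 : K) ≠ 0) :
    ∀ (n : ℕ) (A : Matrix (Fin n) (Fin n) K), Aᵀ = -A → ∃ r, r ^ 2 = A.det := by
  intro n
  induction n using Nat.strong_induction_on with
  | _ n ih =>
    intro A hA
    have hA' : ∀ i j, A j i = -A i j := fun i j => congrFun (congrFun hA i) j
    have hdiag : ∀ i, A i i = 0 := fun i => by
      have h : 2 * A i i = 0 := by linear_combination hA' i i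
      exact (mul_eq_zero.mp h).resolve_left h2
    match n with
    | 0 => exact ⟨1, by simp⟩
    | m + 1 =>
      by_cases h0 : ∀ j, A 0 j = 0
      · exact ⟨0, by rw [Matrix.det_eq_zero_of_row_eq_zero 0 h0]; simp⟩
      push Not at h0
      obtain ⟨j, hj⟩ := h0
      have hj0 : j ≠ 0 := fun h => hj (h ▸ hdiag 0)
      obtain ⟨l, rfl⟩ : ∃ l, m = l + 1 := by
        cases m with
        | zero => exact absurd (Fin.ext (by omega)) hj0
        | succ l => exact ⟨l, rfl⟩
      let e : Fin 2 ⊕ Fin l ≃ Fin (l + 1 + 1) :=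
        (finSumFinEquiv.trans (finCongr (by omega))).trans (Equiv.swap 1 j)
      have e0 : e (Sum.inl 0) = 0 := by
        have h : (finCongr (by omega : 2 + l = l + 1 + 1)) (finSumFinEquiv (Sum.inl 0)) = 0 := by
          ext; simp
        simp only [e, Equiv.trans_apply, h]
        exact Equiv.swap_apply_of_ne_of_ne (by simp) hj0.symm
      have e1 : e (Sum.inl 1) = j := by
        have h : (finCongr (by omega : 2 + l = l + 1 + 1)) (finSumFinEquiv (Sum.inl 1)) = 1 := by
          ext; simp
        simp only [e, Equiv.trans_apply, h, Equiv.swap_apply_left]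
      set B := A.submatrix e e with hB
      have hBt : Bᵀ = -B := by
        ext a b; exact hA' _ _
      set P := B.toBlocks₁₁ with hP
      have hPdet : P.det = A 0 j ^ 2 := by
        rw [Matrix.det_fin_two]
        simp only [hP, hB, Matrix.toBlocks₁₁, Matrix.of_apply, Matrix.submatrix_apply, e0, e1,
          hdiag, hA' 0 j]
        ring
      have hPu : IsUnit P.det := by rw [hPdet]; exact (pow_ne_zero 2 hj).isUnit
      let _ : Invertible P := Matrix.invertibleOfIsUnitDet P hPu
      have hdet : A.det = P.det * (B.toBlocks₂₂ - B.toBlocks₂₁ * ⅟P * B.toBlocks₁₂).det := by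
        rw [← Matrix.det_fromBlocks₁₁, hP, Matrix.fromBlocks_toBlocks, hB,
          Matrix.det_submatrix_equiv_self]
      have hPt : Pᵀ = -P := by ext a b; exact hA' _ _
      have h12 : B.toBlocks₁₂ᵀ = -B.toBlocks₂₁ := by ext a b; exact hA' _ _
      have h21 : B.toBlocks₂₁ᵀ = -B.toBlocks₁₂ := by ext a b; exact hA' _ _
      have h22 : B.toBlocks₂₂ᵀ = -B.toBlocks₂₂ := by ext a b; exact hA' _ _
      have hinv : (⅟P)ᵀ = -⅟P := by
        have h : (⅟P)ᵀ * P = -1 := by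
          have : (P * ⅟P)ᵀ = 1 := by simp
          rw [Matrix.transpose_mul, hPt, Matrix.mul_neg] at this
          exact neg_eq_iff_eq_neg.mp this
        calc (⅟P)ᵀ = (⅟P)ᵀ * (P * ⅟P) := by simp
          _ = -⅟P := by rw [← Matrix.mul_assoc, h]; simp
      obtain ⟨r, hr⟩ := ih l (by omega) (B.toBlocks₂₂ - B.toBlocks₂₁ * ⅟P * B.toBlocks₁₂) (by
        simp only [Matrix.transpose_sub, Matrix.transpose_mul, h12, h21, h22, hinv,
          Matrix.neg_mul, Matrix.mul_neg, neg_neg, Matrix.mul_assoc]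
        abel)
      exact ⟨A 0 j * r, by rw [hdet, hPdet, ← hr]; ring⟩

/-- The determinant of an antisymmetric matrix is a square. -/
theorem exists_sq_eq_det_of_transpose_eq_neg {K ι : Type*} [Field K] [Fintype ι] [DecidableEq ι]
    (h2 : (2 : K) ≠ 0) (A : Matrix ι ι K) (hA : Aᵀ = -A) : ∃ r, r ^ 2 = A.det := by
  let e := Fintype.equivFin ι
  obtain ⟨r, hr⟩ := exists_sq_eq_det_of_transpose_eq_neg_fin h2 _ (A.submatrix e.symm e.symm)
    (by ext a b; exact congrFun (congrFun hA _) _)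
  exact ⟨r, by rw [hr, Matrix.det_submatrix_equiv_self]⟩

/-- A Pfaffian: a polynomial function whose square is the determinant on antisymmetric matrices. -/
theorem exists_mvPolynomial_sq_eq_det (ι : Type*) [Fintype ι] [DecidableEq ι] :
    ∃ g : MvPolynomial (ι × ι) ℝ, ∀ A : Matrix ι ι ℝ, Aᵀ = -A →
      (MvPolynomial.eval (fun p => A p.1 p.2 / 2) g) ^ 2 = A.det := by
  let R := MvPolynomial (ι × ι) ℝ
  let G : Matrix ι ι R := Matrix.of fun i j => MvPolynomial.X (i, j) - MvPolynomial.X (j, i)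
  have h2 : (2 : FractionRing R) ≠ 0 := by
    have : CharZero (FractionRing R) := charZero_of_injective_algebraMap
      (IsFractionRing.injective R (FractionRing R))
    exact two_ne_zero
  obtain ⟨r, hr⟩ := exists_sq_eq_det_of_transpose_eq_neg h2
    ((algebraMap R (FractionRing R)).mapMatrix G) (by ext i j; simp [G])
  rw [← RingHom.map_det] at hr
  obtain ⟨g, rfl⟩ := IsIntegrallyClosed.exists_algebraMap_eq_of_isIntegral_pow (R := R)
    (x := r) two_pos (by rw [hr]; exact isIntegral_algebraMap)
  rw [← map_pow] at hr
  have hg := IsFractionRing.injective R (FractionRing R) hr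
  refine ⟨g, fun A hA => ?_⟩
  rw [← map_pow, hg, RingHom.map_det]
  congr 1
  ext i j
  have : A j i = -A i j := congrFun (congrFun hA i) j
  simp [G, this]
  ring

/-- A Pfaffian is a continuous square root of the determinant on antisymmetric matrices, and it
is an odd function when half of the size is odd. -/
theorem exists_pfaffian {ι : Type*} [Fintype ι] [DecidableEq ι] {k : ℕ}
    (hcard : Fintype.card ι = 2 * k) (hk : Odd k) :
    ∃ pf : Matrix ι ι ℝ → ℝ, Continuous pf ∧ (∀ A, Aᵀ = -A → pf A ^ 2 = A.det) ∧
      ∀ A, Aᵀ = -A → pf (-A) = -pf A := by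
  obtain ⟨g, hg⟩ := exists_mvPolynomial_sq_eq_det ι
  refine ⟨fun A => MvPolynomial.eval (fun p => A p.1 p.2 / 2) g, ?_, fun A hA => ?_, fun A hA => ?_⟩
  · have h : Continuous fun (A : Matrix ι ι ℝ) (p : ι × ι) => A p.1 p.2 / 2 :=
      continuous_pi fun p => (continuous_id.matrix_elem p.1 p.2).div_const 2
    exact (MvPolynomial.continuous_eval g).comp h
  · beta_reduce
    exact hg A hA
  let q : Polynomial ℝ :=
    MvPolynomial.aeval (fun p : ι × ι => Polynomial.C (A p.1 p.2 / 2) * Polynomial.X) g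
  have hq : ∀ t : ℝ, q.eval t = MvPolynomial.eval (fun p => (t • A) p.1 p.2 / 2) g := by
    intro t
    simp only [q]
    rw [MvPolynomial.aeval_def, ← Polynomial.coe_evalRingHom, MvPolynomial.hom_eval₂,
      MvPolynomial.eval_eq, MvPolynomial.eval₂_eq]
    refine Finset.sum_congr rfl fun d _ => ?_
    congr 1
    · simp
    · refine Finset.prod_congr rfl fun p _ => ?_
      simp only [Polynomial.coe_evalRingHom, Polynomial.eval_mul, Polynomial.eval_C,
        Polynomial.eval_X, Matrix.smul_apply, smul_eq_mul]
      ring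
  have hsq : q ^ 2 = (Polynomial.C (q.eval 1) * Polynomial.X ^ k) ^ 2 := by
    refine Polynomial.funext fun t => ?_
    rw [Polynomial.eval_pow, hq, hg _ (by rw [Matrix.transpose_smul, hA, smul_neg]),
      Matrix.det_smul, hcard, hq]
    have := hg A hA
    simp only [one_smul, Polynomial.eval_pow, Polynomial.eval_mul, Polynomial.eval_C,
      Polynomial.eval_X]
    rw [mul_pow, this]
    ring
  have key : q.eval (-1) = -q.eval 1 := by
    rcases sq_eq_sq_iff_eq_or_eq_neg.mp hsq with h | h
    · have := congrArg (Polynomial.eval (-1)) h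
      simpa [hk.neg_one_pow] using this
    · have h1 := congrArg (Polynomial.eval (1 : ℝ)) h
      have h2 := congrArg (Polynomial.eval (-1 : ℝ)) h
      simp [hk.neg_one_pow] at h1 h2
      linarith
  rw [hq, hq, one_smul, neg_one_smul] at key
  exact key

open scoped MatrixOrder ComplexOrder in
/-- A real matrix which is self-adjoint for a nonzero positive semidefinite form has a real
eigenvalue. -/
theorem exists_real_eigenvector_of_mul_posSemidef {ι : Type*} [Fintype ι] [DecidableEq ι]
    {M S : Matrix ι ι ℝ} (hS : S.PosSemidef) (hS0 : S ≠ 0) (h : M * S = S * Mᵀ) :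
    ∃ (z : ℝ) (v : ι → ℝ), v ≠ 0 ∧ M *ᵥ v = z • v := by
  obtain ⟨B, hB⟩ : ∃ B, S = star B * B :=
    CStarAlgebra.nonneg_iff_eq_star_mul_self.mp hS.nonneg
  rw [Matrix.star_eq_conjTranspose] at hB
  let φ : Matrix ι ι ℝ →+* Matrix ι ι ℂ := Complex.ofRealHom.mapMatrix
  have hφt : ∀ A, φ Aᵀ = (φ A)ᴴ := fun A => by ext i j; simp [φ]
  have hSB : φ S = (φ B)ᴴ * φ B := by
    rw [hB, map_mul, ← hφt, Matrix.conjTranspose_eq_transpose_of_trivial]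
  have hMS : φ M * φ S = φ S * (φ M)ᴴ := by rw [← hφt, ← map_mul, ← map_mul, h]
  have hSh : (φ S)ᴴ = φ S := by simp [hSB]
  let V := LinearMap.range (Matrix.mulVecLin (φ S))
  have hV : ∀ x ∈ V, Matrix.mulVecLin (φ M) x ∈ V := by
    rintro _ ⟨u, rfl⟩
    exact ⟨(φ M)ᴴ *ᵥ u, by simp [Matrix.mulVec_mulVec, hMS]⟩
  have : Nontrivial V := by
    rw [Submodule.nontrivial_iff_ne_bot]
    intro hbot
    have h0 : Matrix.mulVecLin (φ S) = 0 := LinearMap.range_eq_bot.mp hbot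
    refine hS0 ?_
    ext i j
    have := congrFun (LinearMap.congr_fun h0 (Pi.single j 1)) i
    simpa [φ] using this
  obtain ⟨μ, hμ⟩ := Module.End.exists_eigenvalue ((Matrix.mulVecLin (φ M)).restrict hV)
  obtain ⟨⟨w, u, huw⟩, hw, hw0⟩ := hμ.exists_hasEigenvector
  have hw0' : w ≠ 0 := fun h => hw0 (Subtype.ext h)
  have hMw : φ M *ᵥ w = μ • w := by
    have := congrArg Subtype.val (Module.End.mem_eigenspace_iff.mp hw)
    simpa using this
  have huw' : φ S *ᵥ u = w := huw
  have hd : star u ⬝ᵥ w ≠ 0 := by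
    intro h0
    rw [← huw', hSB, ← Matrix.mulVec_mulVec, Matrix.dotProduct_mulVec,
      ← Matrix.star_mulVec, dotProduct_star_self_eq_zero] at h0
    exact hw0' (by rw [← huw', hSB, ← Matrix.mulVec_mulVec, h0, Matrix.mulVec_zero])
  have hherm : ∀ T : Matrix ι ι ℂ, Tᴴ = T → star (star u ⬝ᵥ T *ᵥ u) = star u ⬝ᵥ T *ᵥ u := by
    intro T hT
    rw [← Matrix.star_dotProduct_star, star_star, Matrix.star_mulVec, hT, dotProduct_comm,
      Matrix.dotProduct_mulVec, dotProduct_comm]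
  have h1 := hherm (φ S) hSh
  have h2 := hherm (φ M * φ S) (by rw [Matrix.conjTranspose_mul, hSh, hMS])
  rw [huw'] at h1
  rw [← Matrix.mulVec_mulVec, huw', hMw, dotProduct_smul, smul_eq_mul, star_mul', h1] at h2
  have hμr : star μ = μ := mul_right_cancel₀ hd h2
  have hμre : ((μ.re : ℝ) : ℂ) = μ := Complex.conj_eq_iff_re.mp hμr
  have hre : M *ᵥ (fun i => (w i).re) = μ.re • (fun i => (w i).re) := by
    ext i
    have := congrArg Complex.re (congrFun hMw i)
    rw [← hμre] at this
    simpa [φ, Matrix.mulVec, dotProduct] using this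
  have him : M *ᵥ (fun i => (w i).im) = μ.re • (fun i => (w i).im) := by
    ext i
    have := congrArg Complex.im (congrFun hMw i)
    rw [← hμre] at this
    simpa [φ, Matrix.mulVec, dotProduct] using this
  by_cases hr : (fun i => (w i).re) = 0
  · refine ⟨μ.re, _, fun hi => hw0' ?_, him⟩
    ext i
    exact Complex.ext (congrFun hr i) (congrFun hi i)
  · exact ⟨μ.re, _, hr, hre⟩

/-- Positive semidefinite matrices of trace one form a compact set. -/
theorem isCompact_setOf_posSemidef_trace_eq_one (ι : Type*) [Fintype ι] [DecidableEq ι] :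
    IsCompact {S : Matrix ι ι ℝ | S.PosSemidef ∧ S.trace = 1} := by
  have hbox : IsCompact (Set.univ.pi fun _ : ι => Set.univ.pi fun _ : ι => Set.Icc (-1 : ℝ) 1) :=
    isCompact_univ_pi fun _ => isCompact_univ_pi fun _ => isCompact_Icc
  refine IsCompact.of_isClosed_subset (X := Matrix ι ι ℝ) hbox ?_ ?_
  · simp only [Matrix.posSemidef_iff_dotProduct_mulVec, Set.ofPred_and, Set.ofPred_forall]
    refine ((isClosed_eq ?_ ?_).inter (isClosed_iInter fun x => isClosed_le ?_ ?_)).inter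
      (isClosed_eq ?_ ?_) <;> fun_prop
  · rintro S ⟨hS, htr⟩ i - j -
    have hd : ∀ i, 0 ≤ S i i := fun i => hS.diag_nonneg
    have hd1 : ∀ i, S i i ≤ 1 := fun i => by
      rw [← htr]
      exact Finset.single_le_sum (f := fun i => S i i) (fun i _ => hd i) (Finset.mem_univ i)
    have hsym : S j i = S i j := by simpa using hS.1.apply i j
    have h1 := hS.dotProduct_mulVec_nonneg (Pi.single i 1 + Pi.single j 1)
    have h2 := hS.dotProduct_mulVec_nonneg (Pi.single i 1 - Pi.single j 1)
    simp [Matrix.mulVec_add, Matrix.mulVec_sub, add_dotProduct, sub_dotProduct, hsym] at h1 h2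
    have := hd1 i
    have := hd1 j
    constructor <;> linarith

/-- A real matrix without real eigenvalues is tamed by some symplectic form. -/
theorem exists_taming_of_no_real_eigenvector {ι : Type*} [Fintype ι] [DecidableEq ι]
    (M : Matrix ι ι ℝ) (hM : ∀ (z : ℝ) (v : ι → ℝ), v ≠ 0 → M *ᵥ v ≠ z • v) :
    ∃ Ω : Matrix ι ι ℝ, Ωᵀ = -Ω ∧ ∀ x ≠ 0, 0 < x ⬝ᵥ Ω *ᵥ (M *ᵥ x) := by
  have : LocallyConvexSpace ℝ (Matrix ι ι ℝ) :=
    inferInstanceAs (LocallyConvexSpace ℝ (ι → ι → ℝ))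
  let K : Set (Matrix ι ι ℝ) := {S | S.PosSemidef ∧ S.trace = 1}
  have hKc : IsCompact K := isCompact_setOf_posSemidef_trace_eq_one ι
  have hKconv : Convex ℝ K := by
    rintro S ⟨hS, hS'⟩ T ⟨hT, hT'⟩ a b ha hb hab
    exact ⟨(hS.smul ha).add (hT.smul hb), by simp [hS', hT', hab]⟩
  let Φ : Matrix ι ι ℝ →ₗ[ℝ] Matrix ι ι ℝ :=
    LinearMap.mulLeft ℝ M - LinearMap.mulRight ℝ Mᵀ
  have hΦ : ∀ S, Φ S = M * S - S * Mᵀ := fun S => rfl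
  have h0 : (0 : Matrix ι ι ℝ) ∉ Φ '' K := by
    rintro ⟨S, hS, hS0⟩
    obtain ⟨h1, h2⟩ := hS
    obtain ⟨z, v, hv, hz⟩ := exists_real_eigenvector_of_mul_posSemidef (M := M) h1
      (by rintro rfl; simp at h2) (sub_eq_zero.mp hS0)
    exact hM z v hv hz
  have hΦc : IsCompact (Φ '' K) := hKc.image (LinearMap.continuous_of_finiteDimensional Φ)
  obtain ⟨f, u, hf0, hf⟩ := geometric_hahn_banach_point_closed
    (hKconv.linear_image Φ) hΦc.isClosed h0
  rw [map_zero] at hf0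
  let Ω : Matrix ι ι ℝ := Matrix.of fun i j => f (Matrix.single j i 1) - f (Matrix.single i j 1)
  have hfs : ∀ Z : Matrix ι ι ℝ, f Z = ∑ i, ∑ j, Z i j * f (Matrix.single i j 1) := by
    intro Z
    conv_lhs => rw [Matrix.matrix_eq_sum_single Z]
    simp only [map_sum]
    refine Finset.sum_congr rfl fun i _ => Finset.sum_congr rfl fun j _ => ?_
    rw [← smul_eq_mul, ← map_smul, Matrix.smul_single, smul_eq_mul, mul_one]
  have hΩ : ∀ x y, x ⬝ᵥ Ω *ᵥ y = f (Matrix.vecMulVec y x - Matrix.vecMulVec x y) := by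
    intro x y
    rw [map_sub, hfs, hfs, Finset.sum_comm, ← Finset.sum_sub_distrib]
    refine Finset.sum_congr rfl fun i _ => ?_
    rw [Matrix.mulVec, dotProduct, Finset.mul_sum, ← Finset.sum_sub_distrib]
    refine Finset.sum_congr rfl fun j _ => ?_
    simp only [Ω, Matrix.of_apply, Matrix.vecMulVec_apply]
    ring
  have hΩM : ∀ x, x ⬝ᵥ Ω *ᵥ (M *ᵥ x) = f (Φ (Matrix.vecMulVec x x)) := by
    intro x
    rw [hΩ, hΦ, Matrix.mul_vecMulVec, Matrix.vecMulVec_mul, Matrix.vecMul_transpose]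
  refine ⟨Ω, by ext i j; simp [Ω], fun x hx => ?_⟩
  have hn : 0 < x ⬝ᵥ x := by simpa using Matrix.dotProduct_star_self_pos_iff.mpr hx
  have hy : (x ⬝ᵥ x)⁻¹ • Matrix.vecMulVec x x ∈ K := by
    refine ⟨Matrix.PosSemidef.smul ?_ (inv_pos.mpr hn).le, ?_⟩
    · simpa using Matrix.posSemidef_vecMulVec_self_star x
    · rw [Matrix.trace_smul, Matrix.trace_vecMulVec, smul_eq_mul, inv_mul_cancel₀ hn.ne']
  have hpos := hf0.trans (hf _ ⟨_, hy, rfl⟩)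
  rw [map_smul, map_smul, ← hΩM, smul_eq_mul] at hpos
  exact (mul_pos_iff_of_pos_left (inv_pos.mpr hn)).mp hpos

/-- A tamed antisymmetric matrix is nondegenerate. -/
theorem det_ne_zero_of_taming {ι : Type*} [Fintype ι] [DecidableEq ι] {M Ω : Matrix ι ι ℝ}
    (hΩ : Ωᵀ = -Ω) (h : ∀ x ≠ 0, 0 < x ⬝ᵥ Ω *ᵥ (M *ᵥ x)) : Ω.det ≠ 0 := by
  intro h0
  obtain ⟨v, hv, hv0⟩ := Matrix.exists_mulVec_eq_zero_iff.mpr h0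
  have h1 := h v hv
  rw [Matrix.dotProduct_mulVec, ← Matrix.mulVec_transpose, hΩ, Matrix.neg_mulVec, hv0] at h1
  simp at h1

/-- Being tamed by a fixed form is an open condition. -/
theorem isOpen_setOf_taming {ι T : Type*} [Fintype ι] [TopologicalSpace T]
    {M : T → Matrix ι ι ℝ} (hM : Continuous M) (Ω : Matrix ι ι ℝ) :
    IsOpen {t | ∀ x ≠ 0, 0 < x ⬝ᵥ Ω *ᵥ (M t *ᵥ x)} := by
  have hF : Continuous fun p : T × (ι → ℝ) => p.2 ⬝ᵥ Ω *ᵥ (M p.1 *ᵥ p.2) := by fun_prop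
  have heq : {t | ∀ x ≠ 0, 0 < x ⬝ᵥ Ω *ᵥ (M t *ᵥ x)} =
      {t | ∀ x ∈ Metric.sphere (0 : ι → ℝ) 1, 0 < x ⬝ᵥ Ω *ᵥ (M t *ᵥ x)} := by
    ext t
    refine ⟨fun h x hx => h x (by rintro rfl; simp at hx), fun h x hx => ?_⟩
    have hi : 0 < ‖x‖⁻¹ := inv_pos.mpr (norm_pos_iff.mpr hx)
    have hpos := h (‖x‖⁻¹ • x) (by simp [norm_smul, hx])
    simp only [Matrix.mulVec_smul, smul_dotProduct, dotProduct_smul, smul_eq_mul] at hpos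
    exact (mul_pos_iff_of_pos_left hi).mp ((mul_pos_iff_of_pos_left hi).mp hpos)
  rw [heq, isOpen_iff_mem_nhds]
  intro t ht
  refine (isCompact_sphere (0 : ι → ℝ) 1).eventually_forall_of_forall_eventually fun x hx => ?_
  exact hF.continuousAt.eventually (lt_mem_nhds (ht x hx))

/-- If `k` is odd, two real matrices of size `2 * k` have a nontrivial real combination with a
real eigenvalue. -/
theorem exists_combination_real_eigenvector {ι : Type*} [Fintype ι] [DecidableEq ι] {k : ℕ}
    (hcard : Fintype.card ι = 2 * k) (hk : Odd k) (A B : Matrix ι ι ℝ) :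
    ∃ (x y z : ℝ) (v : ι → ℝ), (x ≠ 0 ∨ y ≠ 0) ∧ v ≠ 0 ∧ (x • A + y • B) *ᵥ v = z • v := by
  by_contra! hcon
  obtain ⟨pf, hpfc, hpf, hpfneg⟩ := exists_pfaffian hcard hk
  let M : ℝ → Matrix ι ι ℝ := fun t => Real.cos t • A + Real.sin t • B
  have hM : Continuous M := by fun_prop
  have htame : ∀ t, ∃ Ω : Matrix ι ι ℝ, Ωᵀ = -Ω ∧ ∀ x ≠ 0, 0 < x ⬝ᵥ Ω *ᵥ (M t *ᵥ x) := by
    refine fun t => exists_taming_of_no_real_eigenvector _ fun z v hv => hcon _ _ z v ?_ hv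
    by_contra! h
    have := Real.cos_sq_add_sin_sq t
    simp [h.1, h.2] at this
  let C : ℝ → Set (Matrix ι ι ℝ) :=
    fun t => {Ω | Ωᵀ = -Ω ∧ ∀ x ≠ 0, 0 < x ⬝ᵥ Ω *ᵥ (M t *ᵥ x)}
  have hne : ∀ t, ∀ Ω ∈ C t, pf Ω ≠ 0 := by
    intro t Ω hΩ h0
    have := hpf Ω hΩ.1
    rw [h0] at this
    exact det_ne_zero_of_taming hΩ.1 hΩ.2 (by rw [← this]; simp)
  have hconv : ∀ t, Convex ℝ (C t) := by
    rintro t Ω ⟨hΩ, hΩ'⟩ Ψ ⟨hΨ, hΨ'⟩ a b ha hb hab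
    refine ⟨by simp [hΩ, hΨ, add_comm], fun x hx => ?_⟩
    have h1 := hΩ' x hx
    have h2 := hΨ' x hx
    simp only [Matrix.add_mulVec, Matrix.smul_mulVec, dotProduct_add, dotProduct_smul,
      smul_eq_mul]
    rcases ha.eq_or_lt with rfl | ha'
    · obtain rfl : b = 1 := by linarith
      rwa [zero_mul, one_mul, zero_add]
    · have := mul_pos ha' h1
      have := mul_nonneg hb h2.le
      linarith
  have hopen : ∀ s : Set ℝ, IsOpen {t | ∃ Ω ∈ C t, pf Ω ∈ s} := by
    intro s
    have : {t | ∃ Ω ∈ C t, pf Ω ∈ s} = ⋃ Ω ∈ {Ω : Matrix ι ι ℝ | Ωᵀ = -Ω ∧ pf Ω ∈ s},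
        {t | ∀ x ≠ 0, 0 < x ⬝ᵥ Ω *ᵥ (M t *ᵥ x)} := by
      ext t
      simp only [C, Set.mem_ofPred_eq, Set.mem_iUnion, exists_prop]
      exact exists_congr fun Ω => by tauto
    rw [this]
    exact isOpen_biUnion fun Ω _ => isOpen_setOf_taming hM Ω
  have hneg : ∀ t Ω, Ω ∈ C t → -Ω ∈ C (t + Real.pi) := by
    rintro t Ω ⟨h1, h2⟩
    have hMpi : M (t + Real.pi) = -M t := by
      simp only [M, Real.cos_add_pi, Real.sin_add_pi, neg_smul]
      abel
    exact ⟨by rw [Matrix.transpose_neg, h1], fun x hx => by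
      rw [hMpi, Matrix.neg_mulVec x (M t), Matrix.mulVec_neg, Matrix.neg_mulVec, neg_neg]
      exact h2 x hx⟩
  have hsign : ∀ t, ∃ Ω ∈ C t, pf Ω ∈ Set.Ioi 0 ∪ Set.Iio 0 := by
    intro t
    obtain ⟨Ω, hΩ⟩ := htame t
    exact ⟨Ω, hΩ, (hne t Ω hΩ).lt_or_gt.symm⟩
  have hboth : (∃ t, ∃ Ω ∈ C t, pf Ω ∈ Set.Ioi 0) ∧ ∃ t, ∃ Ω ∈ C t, pf Ω ∈ Set.Iio 0 := by
    obtain ⟨Ω, hΩ, h⟩ := hsign 0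
    have hn := hpfneg Ω hΩ.1
    rcases h with h | h <;> simp only [Set.mem_Ioi, Set.mem_Iio] at h
    · exact ⟨⟨0, Ω, hΩ, h⟩, ⟨_, -Ω, hneg 0 Ω hΩ, by simpa [hn] using h⟩⟩
    · exact ⟨⟨_, -Ω, hneg 0 Ω hΩ, by simpa [hn] using h⟩, ⟨0, Ω, hΩ, h⟩⟩
  obtain ⟨t, -, ⟨Ω, hΩ, hΩp⟩, Ψ, hΨ, hΨn⟩ := isPreconnected_univ (α := ℝ) _ _
    (hopen (Set.Ioi 0)) (hopen (Set.Iio 0))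
    (fun t _ => by
      obtain ⟨Ω, hΩ, h | h⟩ := hsign t
      · exact Or.inl ⟨Ω, hΩ, h⟩
      · exact Or.inr ⟨Ω, hΩ, h⟩)
    (by simpa [Set.Nonempty] using hboth.1) (by simpa [Set.Nonempty] using hboth.2)
  obtain ⟨Θ, hΘ, h0⟩ := (hconv t).isPreconnected.intermediate_value hΨ hΩ hpfc.continuousOn
    (⟨hΨn.le, hΩp.le⟩ : (0 : ℝ) ∈ Set.Icc (pf Ψ) (pf Ω))
  exact hne t Θ hΘ h0

/-- If `k` is odd, two endomorphisms of a real vector space of dimension `2 * k` have a nontrivial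
real combination with a real eigenvalue. -/
theorem exists_combination_real_eigenvector_end {E : Type*} [AddCommGroup E] [Module ℝ E]
    [FiniteDimensional ℝ E] {k : ℕ} (hdim : Module.finrank ℝ E = 2 * k) (hk : Odd k)
    (f g : E →ₗ[ℝ] E) :
    ∃ (x y z : ℝ) (v : E), (x ≠ 0 ∨ y ≠ 0) ∧ v ≠ 0 ∧ x • f v + y • g v = z • v := by
  let b := Module.finBasis ℝ E
  obtain ⟨x, y, z, v, hxy, hv, h⟩ := exists_combination_real_eigenvector
    (by rw [Fintype.card_fin, hdim]) hk (LinearMap.toMatrix b b f) (LinearMap.toMatrix b b g)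
  refine ⟨x, y, z, b.equivFun.symm v, hxy, b.equivFun.symm.map_ne_zero_iff.mpr hv, ?_⟩
  apply b.equivFun.injective
  rw [← map_smul, ← map_smul (LinearMap.toMatrix b b), ← map_add] at h
  have hrepr : v = b.repr (b.equivFun.symm v) := by
    rw [← b.equivFun_apply, LinearEquiv.apply_symm_apply]
  rw [hrepr, LinearMap.toMatrix_mulVec_repr, ← hrepr] at h
  rw [map_smul, LinearEquiv.apply_symm_apply, b.equivFun_apply]
  exact h

/-- Proposition 3.6, in the matrix parametrization of Proposition 3.4:
if `(X, Y)` is an admissible pair of `n×n` complex matrices (encoding a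
pluricomplex structure on `ℝ^{2n}`), then `n` is even. -/
theorem stmt_5 (n : ℕ) (X Y : Matrix (Fin n) (Fin n) ℂ)
    (h1 : ∀ ζ : ℂ, ∀ v : Fin n → ℂ, v ≠ 0 →
      (X + ζ • Y).mulVec v ≠ (starRingEnd ℂ ζ) • star v ∧
      (X + ζ • Y).mulVec v ≠ -((starRingEnd ℂ ζ) • star v))
    (h2 : ∀ v : Fin n → ℂ, v ≠ 0 → Y.mulVec v ≠ star v ∧ Y.mulVec v ≠ -star v) :
    Even n := by
  by_contra hn
  rw [Nat.not_even_iff_odd] at hn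
  have hX : IsUnit X.det := by
    rw [isUnit_iff_ne_zero]
    intro h0
    obtain ⟨v, hv, hXv⟩ := Matrix.exists_mulVec_eq_zero_iff.mpr h0
    exact (h1 0 v hv).1 (by simpa using hXv)
  let f : (Fin n → ℂ) →ₗ[ℝ] (Fin n → ℂ) :=
    { toFun := fun v => Complex.I • v
      map_add' := fun _ _ => smul_add _ _ _
      map_smul' := fun c v => smul_comm _ _ _ }
  let g : (Fin n → ℂ) →ₗ[ℝ] (Fin n → ℂ) :=
    { toFun := fun v => X⁻¹ *ᵥ (Y *ᵥ v - star v)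
      map_add' := fun v w => by
        rw [← Matrix.mulVec_add, Matrix.mulVec_add Y, star_add, add_sub_add_comm]
      map_smul' := fun c v => by
        rw [Matrix.mulVec_smul, star_smul, star_trivial, ← smul_sub, Matrix.mulVec_smul]
        rfl }
  obtain ⟨x, y, z, v, hxy, hv, h⟩ := exists_combination_real_eigenvector_end
    (by rw [Module.finrank_pi_fintype]; simp [Complex.finrank_real_complex, mul_comm]) hn f g
  have hfv : f v = Complex.I • v := rfl
  have hgv : X *ᵥ g v = Y *ᵥ v - star v := by
    change X *ᵥ (X⁻¹ *ᵥ (Y *ᵥ v - star v)) = _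
    rw [Matrix.mulVec_mulVec, Matrix.mul_nonsing_inv _ hX, Matrix.one_mulVec]
  have hcomb : (x * Complex.I - z : ℂ) • X *ᵥ v + (y : ℂ) • (Y *ᵥ v - star v) = 0 := by
    rw [← hgv, ← Matrix.mulVec_smul, ← Matrix.mulVec_smul, ← Matrix.mulVec_add]
    have : (x * Complex.I - z : ℂ) • v + (y : ℂ) • g v = 0 := by
      rw [sub_smul, mul_smul, ← hfv, Complex.coe_smul, Complex.coe_smul, Complex.coe_smul,
        sub_add_eq_add_sub, h, sub_self]
    rw [this, Matrix.mulVec_zero]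
  rcases eq_or_ne y 0 with rfl | hy
  · have hx : x ≠ 0 := by simpa using hxy
    have hc : (x * Complex.I - z : ℂ) ≠ 0 := fun hc => hx (by simpa using congrArg Complex.im hc)
    rw [Complex.ofReal_zero, zero_smul, add_zero, smul_eq_zero_iff_right hc] at hcomb
    exact (h1 0 v hv).1 (by simpa using hcomb)
  · have hy' : (y : ℂ) ≠ 0 := Complex.ofReal_ne_zero.mpr hy
    set a : ℂ := (x * Complex.I - z) / y with ha
    have hcomb' : a • X *ᵥ v + (Y *ᵥ v - star v) = 0 := by
      have h3 := congrArg (fun w => (y : ℂ)⁻¹ • w) hcomb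
      simpa only [smul_add, smul_smul, inv_mul_cancel₀ hy', one_smul, smul_zero, ha,
        div_eq_inv_mul] using h3
    rcases eq_or_ne a 0 with ha0 | ha0
    · rw [ha0, zero_smul, zero_add, sub_eq_zero] at hcomb'
      exact (h2 v hv).1 hcomb'
    · refine (h1 a⁻¹ (a • v) (smul_ne_zero ha0 hv)).1 ?_
      rw [Matrix.add_mulVec, Matrix.smul_mulVec, Matrix.mulVec_smul, Matrix.mulVec_smul,
        inv_smul_smul₀ ha0, star_smul, smul_smul]
      have : (starRingEnd ℂ) a⁻¹ * star a = 1 := by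
        rw [← Complex.star_def, ← star_mul', inv_mul_cancel₀ ha0, star_one]
      rw [this, one_smul, ← sub_eq_zero, add_sub_assoc, hcomb']
end

section
/- Let B₁, B₂ be n×n complex matrices, and for ζ ∈ ℂ set U_ζ = {(v + ζB₁v, ζB₂v) : v ∈ ℂⁿ} ⊆ ℂⁿ × ℂⁿ. If U_ζ ∩ U_{ζ'} = {0} for all distinct ζ, ζ' ∈ ℂ, then B₂ is invertible. -/
open Matrix

/-- The step in the proof of Proposition 3.4: if the subspaces
`U_ζ = {(v + ζB₁v, ζB₂v)}` of `ℂⁿ × ℂⁿ` intersect pairwise trivially for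
distinct `ζ ∈ ℂ`, then `B₂` is invertible. -/
theorem stmt_7 (n : ℕ) (B₁ B₂ : Matrix (Fin n) (Fin n) ℂ)
    (h : ∀ ζ ζ' : ℂ, ζ ≠ ζ' →
      {p : (Fin n → ℂ) × (Fin n → ℂ) |
        ∃ v : Fin n → ℂ, p = (v + ζ • B₁.mulVec v, ζ • B₂.mulVec v)} ∩
      {p : (Fin n → ℂ) × (Fin n → ℂ) |
        ∃ v : Fin n → ℂ, p = (v + ζ' • B₁.mulVec v, ζ' • B₂.mulVec v)} = {0}) :
    IsUnit B₂ := by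
  rw [← Matrix.mulVec_injective_iff_isUnit]
  refine (injective_iff_map_eq_zero (Matrix.mulVecLin B₂)).2 fun v hv => ?_
  rw [Matrix.mulVecLin_apply] at hv
  have key (ζ : ℂ) (hζ : ζ ≠ 0) : v + ζ • B₁.mulVec v = 0 := by
    have hmem : (v + ζ • B₁.mulVec v, (0 : Fin n → ℂ)) ∈ ({0} : Set _) := by
      rw [← h ζ 0 hζ]
      exact ⟨⟨v, by simp [hv]⟩, ⟨v + ζ • B₁.mulVec v, by simp⟩⟩
    exact congrArg Prod.fst hmem
  have hpos := key 1 one_ne_zero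
  have hneg := key (-1) (neg_ne_zero.2 one_ne_zero)
  ext i
  have hpos_i := congrFun hpos i
  have hneg_i := congrFun hneg i
  simp only [Pi.add_apply, Pi.smul_apply, Pi.zero_apply, smul_eq_mul] at hpos_i hneg_i ⊢
  linear_combination (hpos_i + hneg_i) / 2
end

section
/- Let X, Y be n×n complex matrices such that X is invertible and YȲ − I is invertible. Let m ≥ 1 and let v₀, v₁, …, v_m be n-tuples of polynomials in one variable ζ over ℂ, each component of each v_i having degree at most m−1, such that for every i with 0 ≤ i ≤ m−1 one has the identity of polynomial vectors X̄·v_{i+1}(ζ) = (XȲ + ζ·(YȲ − I))·v_i(ζ). Then v_i = 0 for every i = 0, …, m. -/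
open Matrix Polynomial

section PencilMulVec

variable {ι R : Type*} [Fintype ι] [CommRing R]

theorem coeff_map_C_mulVec (M : Matrix ι ι R) (u : ι → R[X]) (k : ℕ) :
    (fun j => ((M.map (C : R →+* R[X])).mulVec u j).coeff k) =
      M.mulVec fun j => (u j).coeff k := by
  ext j
  simp [Matrix.mulVec, dotProduct]

theorem coeff_succ_pencil_mulVec (A B : Matrix ι ι R) (u : ι → R[X]) (k : ℕ) :
    (fun j => ((A.map (C : R →+* R[X]) + (X : R[X]) • B.map (C : R →+* R[X])).mulVec u j).coeff
        (k + 1)) =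
      (A.mulVec fun j => (u j).coeff (k + 1)) + B.mulVec fun j => (u j).coeff k := by
  rw [← coeff_map_C_mulVec, ← coeff_map_C_mulVec]
  ext j
  simp [Matrix.add_mulVec, Matrix.smul_mulVec, coeff_X_mul]

variable [DecidableEq ι]

/-- If `L w = (A + ζ B) u` with `B` invertible, then the degree of `u` is less than that of `w`. -/
theorem coeff_eq_zero_of_pencil_mulVec {L A B : Matrix ι ι R} (hB : IsUnit B) {u w : ι → R[X]}
    (h : (L.map (C : R →+* R[X])).mulVec w =
      (A.map (C : R →+* R[X]) + (X : R[X]) • B.map (C : R →+* R[X])).mulVec u)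
    {d N : ℕ} (hu : ∀ k, N ≤ k → (fun j => (u j).coeff k) = 0)
    (hw : ∀ k, d + 1 ≤ k → (fun j => (w j).coeff k) = 0) :
    ∀ k, d ≤ k → (fun j => (u j).coeff k) = 0 := by
  intro k hk
  rcases le_total N k with hN | hN
  · exact hu k hN
  induction hN using Nat.decreasingInduction with
  | self => exact hu N le_rfl
  | of_succ k _ ih =>
    have e := coeff_succ_pencil_mulVec A B u k
    rw [← h, coeff_map_C_mulVec, hw _ (by lia), ih (by lia), mulVec_zero, mulVec_zero,
      zero_add] at e
    exact mulVec_injective_of_isUnit hB (by rw [← e, mulVec_zero])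

end PencilMulVec

/-- The core recursion in the proof of the Appendix Proposition (strong
regularity of characteristic sheaves): if `X` is invertible, `YȲ − I` is
invertible, and `v₀, …, v_m` are vectors of polynomials of degree ≤ m−1
satisfying `X̄·v_{i+1}(ζ) = (XȲ + ζ(YȲ − I))·v_i(ζ)`, then all `v_i` vanish. -/
theorem stmt_8 (n m : ℕ) (hm : 1 ≤ m) (X Y : Matrix (Fin n) (Fin n) ℂ)
    (hX : IsUnit X) (hY : IsUnit (Y * Y.map (starRingEnd ℂ) - 1))
    (v : Fin (m + 1) → Fin n → Polynomial ℂ)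
    (hdeg : ∀ i j, (v i j).degree ≤ (m - 1 : ℕ))
    (hrec : ∀ i : Fin m,
      (((X.map (starRingEnd ℂ)).map (Polynomial.C : ℂ →+* Polynomial ℂ))).mulVec (v i.succ) =
      ((X * Y.map (starRingEnd ℂ)).map (Polynomial.C : ℂ →+* Polynomial ℂ) +
        (Polynomial.X : Polynomial ℂ) •
          ((Y * Y.map (starRingEnd ℂ) - 1).map (Polynomial.C : ℂ →+* Polynomial ℂ))).mulVec
        (v i.castSucc)) :
    ∀ i, v i = 0 := by
  have hcoeff : ∀ i k, m ≤ k → (fun j => (v i j).coeff k) = 0 := fun i k hk => by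
    ext j
    exact coeff_eq_zero_of_degree_lt ((hdeg i j).trans_lt (by exact_mod_cast (by lia : m - 1 < k)))
  have hlow : ∀ i : Fin (m + 1), ∀ k, (i : ℕ) ≤ k → (fun j => (v i j).coeff k) = 0 := by
    intro i
    induction i using Fin.reverseInduction with
    | last => exact hcoeff _
    | cast i ih =>
      exact coeff_eq_zero_of_pencil_mulVec hY (hrec i) (hcoeff _) (by simpa using ih)
  have hX' : IsUnit ((X.map (starRingEnd ℂ)).map (Polynomial.C : ℂ →+* Polynomial ℂ)) :=
    (hX.map (starRingEnd ℂ).mapMatrix).map (Polynomial.C : ℂ →+* Polynomial ℂ).mapMatrix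
  intro i
  induction i using Fin.induction with
  | zero =>
    ext j k
    exact congrFun (hlow 0 k (Nat.zero_le k)) j
  | succ i ih =>
    refine mulVec_injective_of_isUnit hX' ?_
    rw [hrec i, ih, mulVec_zero, mulVec_zero]
end

section
/- Let N be a natural number, let J, J' be real N×N matrices with J·J = −I and J'·J' = −I, and let U = {x ∈ ℂ^N : Jx = ix}, U' = {x ∈ ℂ^N : J'x = ix} be the i-eigenspaces in ℂ^N of the complexified matrices. Assume U ∩ U' = {0}. Then U + U' = ℂ^N, and any ℂ-linear endomorphism T of ℂ^N satisfying Tx = ix for all x ∈ U and Tx = −ix for all x ∈ U' satisfies T∘T = −id; moreover, for every nonzero v ∈ ℝ^N (viewed in ℂ^N), Tv ≠ iv and Tv ≠ −iv. -/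
open Matrix Pointwise

/-- For a complex structure `J` and a real vector `v`, the vector `v - iJv` is of type `(1,0)`. -/
theorem mulVec_ofReal_sub_I_smul {n : Type*} [Fintype n] [DecidableEq n] {J : Matrix n n ℝ}
    (hJ : J * J = -1) (v : n → ℝ) :
    (J.map Complex.ofReal).mulVec (fun i => (v i : ℂ) - Complex.I * (J.mulVec v i : ℂ)) =
      Complex.I • (fun i => (v i : ℂ) - Complex.I * (J.mulVec v i : ℂ)) := by
  have hJJ : J.mulVec (J.mulVec v) = -v := by
    rw [Matrix.mulVec_mulVec, hJ, Matrix.neg_mulVec, Matrix.one_mulVec]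
  have key : ∀ w : n → ℝ, (J.map Complex.ofReal).mulVec (fun i => (w i : ℂ)) =
      fun i => (J.mulVec w i : ℂ) := by
    intro w
    ext i
    simp [Matrix.mulVec, dotProduct]
  have hsplit : (fun i => (v i : ℂ) - Complex.I * (J.mulVec v i : ℂ)) =
      (fun i => (v i : ℂ)) - Complex.I • (fun i => (J.mulVec v i : ℂ)) := rfl
  rw [hsplit, Matrix.mulVec_sub, Matrix.mulVec_smul, key, key, hJJ, smul_sub, smul_smul,
    Complex.I_mul_I]
  ext i
  simp
  ring

/-- A real matrix has no nonzero real eigenvector with eigenvalue `i`. -/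
theorem eq_zero_of_map_ofReal_mulVec_eq_I_smul {n : Type*} [Fintype n] {J : Matrix n n ℝ}
    {v : n → ℝ} (h : (J.map Complex.ofReal).mulVec (fun i => (v i : ℂ)) =
      Complex.I • (fun i => (v i : ℂ))) : v = 0 := by
  ext i
  have := congrArg Complex.im (congrFun h i)
  simpa [Matrix.mulVec, dotProduct] using this.symm

/-- If two complex structures have no common nonzero vector of type `(1,0)`, then every complex
vector is a sum of vectors of type `(1,0)` for each of them. -/
theorem exists_add_of_transversal {n : Type*} [Fintype n] [DecidableEq n] {J J' : Matrix n n ℝ}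
    (hJ : J * J = -1) (hJ' : J' * J' = -1)
    (hU : ∀ x : n → ℂ, (J.map Complex.ofReal).mulVec x = Complex.I • x →
      (J'.map Complex.ofReal).mulVec x = Complex.I • x → x = 0) (z : n → ℂ) :
    ∃ x y : n → ℂ, (J.map Complex.ofReal).mulVec x = Complex.I • x ∧
      (J'.map Complex.ofReal).mulVec y = Complex.I • y ∧ x + y = z := by
  have hinj : Function.Injective (J - J').mulVecLin := by
    rw [injective_iff_map_eq_zero]
    intro v hv
    rw [Matrix.mulVecLin_apply, Matrix.sub_mulVec, sub_eq_zero] at hv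
    have hv' := mulVec_ofReal_sub_I_smul hJ' v
    rw [← hv] at hv'
    have h0 := hU _ (mulVec_ofReal_sub_I_smul hJ v) hv'
    ext i
    simpa using congrArg Complex.re (congrFun h0 i)
  obtain ⟨v, hv⟩ := LinearMap.injective_iff_surjective.mp hinj
    (-(fun i => (z i).im) - J'.mulVec (fun i => (z i).re))
  refine ⟨_, _, mulVec_ofReal_sub_I_smul hJ v,
    mulVec_ofReal_sub_I_smul hJ' ((fun i => (z i).re) - v), ?_⟩
  ext i
  have hi := congrFun hv i
  simp only [Matrix.mulVecLin_apply, Matrix.sub_mulVec, Pi.sub_apply, Pi.neg_apply] at hi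
  apply Complex.ext
  · simp
  · simp only [Matrix.mulVec_sub, Pi.add_apply, Pi.sub_apply, Complex.add_im, Complex.sub_im,
      Complex.ofReal_im, Complex.I_mul_im, Complex.ofReal_re]
    linarith

/-- The pointwise construction underlying Lemma 4.1 and Theorem 4.2 (forward
direction): if the i-eigenspaces `U`, `U'` of two complexified linear complex
structures `J`, `J'` on `ℝ^N` intersect trivially, then `U + U' = ℂ^N`, and any
ℂ-linear `T` acting as `i` on `U` and as `−i` on `U'` satisfies `T² = −id` and
has no real eigenvectors. -/
theorem stmt_9 (N : ℕ) (J J' : Matrix (Fin N) (Fin N) ℝ)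
    (hJ : J * J = -1) (hJ' : J' * J' = -1)
    (hU : {x : Fin N → ℂ | (J.map Complex.ofReal).mulVec x = Complex.I • x} ∩
      {x : Fin N → ℂ | (J'.map Complex.ofReal).mulVec x = Complex.I • x} = {0}) :
    ({x : Fin N → ℂ | (J.map Complex.ofReal).mulVec x = Complex.I • x} +
      {x : Fin N → ℂ | (J'.map Complex.ofReal).mulVec x = Complex.I • x} = Set.univ) ∧
    ∀ T : (Fin N → ℂ) →ₗ[ℂ] (Fin N → ℂ),
      (∀ x : Fin N → ℂ, (J.map Complex.ofReal).mulVec x = Complex.I • x →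
        T x = Complex.I • x) →
      (∀ x : Fin N → ℂ, (J'.map Complex.ofReal).mulVec x = Complex.I • x →
        T x = -(Complex.I • x)) →
      (T ∘ₗ T = -LinearMap.id ∧
        ∀ v : Fin N → ℝ, v ≠ 0 →
          T (fun i => (v i : ℂ)) ≠ Complex.I • (fun i => (v i : ℂ)) ∧
          T (fun i => (v i : ℂ)) ≠ -(Complex.I • (fun i => (v i : ℂ)))) := by
  have hspan := exists_add_of_transversal hJ hJ' fun x hx hx' => by
    have hmem : x ∈ ({0} : Set (Fin N → ℂ)) := hU ▸ ⟨hx, hx'⟩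
    exact hmem
  refine ⟨Set.eq_univ_of_forall fun z => ?_, fun T hT hT' => ⟨?_, fun v hv => ⟨?_, ?_⟩⟩⟩
  · obtain ⟨x, y, hx, hy, rfl⟩ := hspan z
    exact Set.add_mem_add hx hy
  · refine LinearMap.ext fun z => ?_
    obtain ⟨x, y, hx, hy, rfl⟩ := hspan z
    simp [hT x hx, hT' y hy, smul_smul, add_comm]
  · intro h
    obtain ⟨x, y, hx, hy, hxy⟩ := hspan (fun i => (v i : ℂ))
    rw [← hxy, map_add, hT x hx, hT' y hy, smul_add, add_right_inj, neg_eq_self,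
      smul_eq_zero_iff_right Complex.I_ne_zero] at h
    rw [h, add_zero] at hxy
    exact hv (eq_zero_of_map_ofReal_mulVec_eq_I_smul (hxy ▸ hx))
  · intro h
    obtain ⟨x, y, hx, hy, hxy⟩ := hspan (fun i => (v i : ℂ))
    rw [← hxy, map_add, hT x hx, hT' y hy, smul_add, neg_add, add_left_inj, self_eq_neg,
      smul_eq_zero_iff_right Complex.I_ne_zero] at h
    rw [h, zero_add] at hxy
    exact hv (eq_zero_of_map_ofReal_mulVec_eq_I_smul (hxy ▸ hy))
end

section
/- Let T be a ℂ-linear endomorphism of ℂ^N with T∘T = −id, and suppose that no nonzero vector v ∈ ℂ^N with v̄ = v (i.e. no nonzero real vector) satisfies Tv = iv or Tv = −iv. Let U = {x ∈ ℂ^N : Tx = ix} and let Ū = {x̄ : x ∈ U} be its image under entrywise complex conjugation. Then U ∩ Ū = {0} and U + Ū = ℂ^N. -/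
open Matrix Pointwise

/-- If `c` has no real eigenvector for `T`, then the `c`-eigenspace of `T` meets its complex
conjugate only in `0`. -/
theorem eq_zero_of_eigenvector_of_star_eigenvector {ι : Type*} (T : (ι → ℂ) →ₗ[ℂ] (ι → ℂ)) (c : ℂ)
    (hreal : ∀ v : ι → ℂ, star v = v → v ≠ 0 → T v ≠ c • v) {x : ι → ℂ}
    (hx : T x = c • x) (hsx : T (star x) = c • star x) : x = 0 := by
  have hre : x + star x = 0 := by
    by_contra hne
    refine hreal (x + star x) (by simp [add_comm]) hne ?_
    rw [map_add, hx, hsx, smul_add]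
  have him : Complex.I • (x - star x) = 0 := by
    by_contra hne
    refine hreal (Complex.I • (x - star x)) (by simp [star_smul, ← smul_neg]) hne ?_
    rw [map_smul, map_sub, hx, hsx, ← smul_sub, smul_comm]
  have hsub : x = star x := sub_eq_zero.mp ((smul_eq_zero.mp him).resolve_left Complex.I_ne_zero)
  rw [← hsub] at hre
  exact self_eq_neg.mp (eq_neg_of_add_eq_zero_left hre)

/-- The complex conjugate `x ↦ star (T (star x))` of a `ℂ`-linear endomorphism. -/
def conjEnd {ι : Type*} (T : (ι → ℂ) →ₗ[ℂ] (ι → ℂ)) : (ι → ℂ) →ₗ[ℂ] (ι → ℂ) where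
  toFun x := star (T (star x))
  map_add' x y := by simp
  map_smul' c x := by simp [star_smul]

theorem conjEnd_apply {ι : Type*} (T : (ι → ℂ) →ₗ[ℂ] (ι → ℂ)) (x : ι → ℂ) :
    conjEnd T x = star (T (star x)) := rfl

/-- The pointwise content of the converse direction (ii)⇒(i) of Theorem 4.2:
a ℂ-linear endomorphism `T` of `ℂ^N` with `T² = −id` and with no real
eigenvectors has i-eigenspace `U` transversal to its complex conjugate `Ū`,
and `U + Ū = ℂ^N`. -/
theorem stmt_10 (N : ℕ) (T : (Fin N → ℂ) →ₗ[ℂ] (Fin N → ℂ))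
    (hT : T ∘ₗ T = -LinearMap.id)
    (hreal : ∀ v : Fin N → ℂ, star v = v → v ≠ 0 →
      T v ≠ Complex.I • v ∧ T v ≠ -(Complex.I • v)) :
    ({x : Fin N → ℂ | T x = Complex.I • x} ∩
      ((fun x : Fin N → ℂ => star x) '' {x : Fin N → ℂ | T x = Complex.I • x}) = {0}) ∧
    ({x : Fin N → ℂ | T x = Complex.I • x} +
      ((fun x : Fin N → ℂ => star x) '' {x : Fin N → ℂ | T x = Complex.I • x}) = Set.univ) := by
  have hTT (x : Fin N → ℂ) : T (T x) = -x := by simpa using LinearMap.congr_fun hT x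
  have hI (x : Fin N → ℂ) : Complex.I • Complex.I • x = -x := by simp [smul_smul]
  have hpos {x : Fin N → ℂ} := eq_zero_of_eigenvector_of_star_eigenvector T Complex.I
    (fun v hv h0 => (hreal v hv h0).1) (x := x)
  have hneg {x : Fin N → ℂ} := eq_zero_of_eigenvector_of_star_eigenvector T (-Complex.I)
    (fun v hv h0 => by simpa only [neg_smul] using (hreal v hv h0).2) (x := x)
  have hproj (x : Fin N → ℂ) : T (T x + Complex.I • x) = Complex.I • (T x + Complex.I • x) := by
    rw [map_add, map_smul, hTT, smul_add, hI, add_comm]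
  have hstar (x : Fin N → ℂ) :
      star (T (star x) + Complex.I • star x) = conjEnd T x - Complex.I • x := by
    simp [conjEnd_apply, star_smul, sub_eq_add_neg]
  have hsurj : Function.Surjective (T + conjEnd T) := by
    rw [← LinearMap.injective_iff_surjective, injective_iff_map_eq_zero]
    intro x hx
    have hsum : (T x + Complex.I • x) + star (T (star x) + Complex.I • star x) = 0 := by
      rw [hstar, add_add_sub_cancel]
      exact hx
    have hstar_eq : star (T x + Complex.I • x) = -(T (star x) + Complex.I • star x) := by
      rw [eq_neg_of_add_eq_zero_left hsum, star_neg, star_star]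
    have hzero : T x + Complex.I • x = 0 :=
      hpos (hproj x) (by rw [hstar_eq, map_neg, hproj, smul_neg])
    rw [hzero, star_zero, eq_comm, neg_eq_zero] at hstar_eq
    exact hneg (by rw [neg_smul]; exact eq_neg_of_add_eq_zero_left hzero)
      (by rw [neg_smul]; exact eq_neg_of_add_eq_zero_left hstar_eq)
  constructor
  · ext x
    constructor
    · rintro ⟨hx, y, hy, rfl⟩
      exact hpos hx (by simpa using hy)
    · rintro rfl
      exact ⟨by simp, 0, by simp, star_zero _⟩
  · refine Set.eq_univ_of_forall fun y => ?_
    obtain ⟨x, rfl⟩ := hsurj y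
    refine ⟨_, hproj x, _, ⟨_, hproj (star x), rfl⟩, ?_⟩
    simp only [hstar, add_add_sub_cancel, LinearMap.add_apply]
end

section
/- Let X, Y be n×n complex matrices with X invertible, and let ζ, η ∈ ℂ. Set W_ζ = {(Xv + ζYv, ζv) : v ∈ ℂⁿ} ⊆ ℂⁿ × ℂⁿ and Ŵ_η = {(w, (Ȳ − ηX̄)w) : w ∈ ℂⁿ} ⊆ ℂⁿ × ℂⁿ. Then W_ζ ∩ Ŵ_η ≠ {0} if and only if det((ηX̄ − Ȳ)(X + ζY) + ζI) = 0. -/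
open Matrix

/-- Proposition 2.2(i) together with Remark (M) of Section 3: the subspaces
`W_ζ = {(Xv + ζYv, ζv)}` and `Ŵ_η = {(w, (Ȳ − ηX̄)w)}` of `ℂⁿ × ℂⁿ` intersect
nontrivially iff `det((ηX̄ − Ȳ)(X + ζY) + ζI) = 0`, i.e. `(ζ,η)` lies on the
characteristic curve of the structure encoded by `(X, Y)`. -/
theorem stmt_11 (n : ℕ) (X Y : Matrix (Fin n) (Fin n) ℂ) (hX : IsUnit X) (ζ η : ℂ) :
    ({p : (Fin n → ℂ) × (Fin n → ℂ) |
        ∃ v : Fin n → ℂ, p = (X.mulVec v + ζ • Y.mulVec v, ζ • v)} ∩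
      {p : (Fin n → ℂ) × (Fin n → ℂ) |
        ∃ w : Fin n → ℂ,
          p = (w, (Y.map (starRingEnd ℂ) - η • X.map (starRingEnd ℂ)).mulVec w)}
      ≠ {0})
    ↔
    ((η • X.map (starRingEnd ℂ) - Y.map (starRingEnd ℂ)) * (X + ζ • Y) + ζ • 1).det = 0 := by
  set B : Matrix (Fin n) (Fin n) ℂ := Y.map (starRingEnd ℂ) - η • X.map (starRingEnd ℂ) with hB
  have hneg : η • X.map (starRingEnd ℂ) - Y.map (starRingEnd ℂ) = -B := by rw [hB, neg_sub]
  have hker (v : Fin n → ℂ) : (-B * (X + ζ • Y) + ζ • (1 : Matrix (Fin n) (Fin n) ℂ)) *ᵥ v = 0 ↔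
      ζ • v = B *ᵥ (X *ᵥ v + ζ • Y *ᵥ v) := by
    rw [add_mulVec, ← mulVec_mulVec, add_mulVec, smul_mulVec, smul_mulVec, one_mulVec,
      neg_mulVec, neg_add_eq_zero, eq_comm]
  rw [hneg, ← exists_mulVec_eq_zero_iff]
  simp only [hker]
  constructor
  · intro h
    by_contra! hzero
    refine h (Set.eq_singleton_iff_unique_mem.2
      ⟨⟨⟨0, by simp [Prod.ext_iff]⟩, ⟨0, by simp [Prod.ext_iff]⟩⟩, ?_⟩)
    rintro p ⟨⟨v, rfl⟩, ⟨w, hw⟩⟩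
    obtain ⟨rfl, hv⟩ := Prod.mk.inj hw
    obtain rfl : v = 0 := by
      by_contra hv0
      exact hzero v hv0 hv
    simp
  · rintro ⟨v, hv0, hv⟩ h
    have hmem : (X *ᵥ v + ζ • Y *ᵥ v, ζ • v) ∈ ({0} : Set ((Fin n → ℂ) × (Fin n → ℂ))) := by
      rw [← h]
      exact ⟨⟨v, rfl⟩, ⟨_, Prod.ext rfl hv⟩⟩
    obtain ⟨hXv, hζv⟩ := Prod.mk.inj (Set.mem_singleton_iff.1 hmem)
    obtain rfl : ζ = 0 := (smul_eq_zero.1 hζv).resolve_right hv0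
    rw [zero_smul, add_zero] at hXv
    exact hv0 (mulVec_injective_of_isUnit hX (by rw [hXv, mulVec_zero]))
end

section
/- Let X be an n×n complex matrix with X̄·X = −I. Then: (1) the pair (X, 0) is admissible, i.e. for every ζ ∈ ℂ and every nonzero v ∈ ℂⁿ, Xv ≠ ζ̄v̄ and Xv ≠ −ζ̄v̄, and for every nonzero v ∈ ℂⁿ, 0 ≠ v̄ and 0 ≠ −v̄; and (2) for all ζ, η ∈ ℂ, det(ηX̄·X + ζI) = (ζ − η)ⁿ, so the characteristic polynomial det((ηX̄ − Ȳ)(X + ζY) + ζI) of the pair (X, Y) = (X, 0) vanishes exactly on the diagonal ζ = η. -/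
open Matrix

/-- If `X̄ X = -1`, then `X v = c v̄` has no nonzero solution `v`. -/
theorem mulVec_ne_smul_star_of_map_conj_mul_self {m : Type*} [Fintype m] [DecidableEq m]
    {X : Matrix m m ℂ} (hX : X.map (starRingEnd ℂ) * X = -1) {v : m → ℂ} (hv : v ≠ 0) (c : ℂ) :
    X *ᵥ v ≠ c • star v := by
  intro h
  have hstar : X.map (starRingEnd ℂ) *ᵥ star v = star (X *ᵥ v) := by
    ext i
    simp [mulVec, dotProduct]
  have hneg : (c * starRingEnd ℂ c) • v = -v := by
    calc (c * starRingEnd ℂ c) • v = c • star (c • star v) := by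
          ext i
          simp [mul_assoc]
      _ = X.map (starRingEnd ℂ) *ᵥ (X *ᵥ v) := by rw [← h, ← hstar, ← mulVec_smul, h]
      _ = -v := by rw [mulVec_mulVec, hX, neg_mulVec, one_mulVec]
  have hzero : (c * starRingEnd ℂ c + 1) • v = 0 := by
    rw [add_smul, hneg, one_smul, neg_add_cancel]
  refine hv ((smul_eq_zero.mp hzero).resolve_left fun hc => ?_)
  rw [Complex.mul_conj] at hc
  have hre : Complex.normSq c + 1 = 0 := by exact_mod_cast hc
  linarith [Complex.normSq_nonneg c]

/-- The forward direction of Proposition 3.7: if `X̄·X = −I` then the pair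
`(X, 0)` is admissible (it encodes a hypercomplex structure), and
`det(ηX̄·X + ζI) = (ζ − η)ⁿ`, so the characteristic polynomial of `(X, 0)`
vanishes exactly on the diagonal `ζ = η`. -/
theorem stmt_13 (n : ℕ) (X : Matrix (Fin n) (Fin n) ℂ)
    (hX : X.map (starRingEnd ℂ) * X = -1) :
    ((∀ ζ : ℂ, ∀ v : Fin n → ℂ, v ≠ 0 →
        X.mulVec v ≠ (starRingEnd ℂ ζ) • star v ∧
        X.mulVec v ≠ -((starRingEnd ℂ ζ) • star v)) ∧
      (∀ v : Fin n → ℂ, v ≠ 0 →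
        (0 : Fin n → ℂ) ≠ star v ∧ (0 : Fin n → ℂ) ≠ -star v)) ∧
    (∀ ζ η : ℂ, (η • (X.map (starRingEnd ℂ) * X) + ζ • 1).det = (ζ - η) ^ n) := by
  refine ⟨⟨fun ζ v hv => ⟨mulVec_ne_smul_star_of_map_conj_mul_self hX hv _, ?_⟩,
    fun v hv => ⟨?_, ?_⟩⟩, fun ζ η => ?_⟩
  · rw [← neg_smul]
    exact mulVec_ne_smul_star_of_map_conj_mul_self hX hv _
  · exact (star_ne_zero.mpr hv).symm
  · exact (neg_ne_zero.mpr (star_ne_zero.mpr hv)).symm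
  · rw [hX, smul_neg, neg_add_eq_sub, ← sub_smul, det_smul, det_one, mul_one, Fintype.card_fin]
end
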